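/- There exists a universal constant C' > 0 such that the following holds. Let N, q, h, T, L, M, U be positive integers, let X ∈ ℝ^{N×q}, and let Ā ∈ ℝ^{N×N} be a real symmetric matrix with eigenvalues λ_1, …, λ_N. Let σ : ℝ → ℝ be 1-Lipschitz with σ(0) = 0 and |σ(t)| ≤ R for all t ∈ ℝ. Fix nonnegative reals B^{(0)}, …, B^{(T+1)} and a real γ ≥ 0. For weight matrices W^{(0)} ∈ ℝ^{q×h}, W^{(1)}, …, W^{(T)} ∈ ℝ^{h×h}, W^{(T+1)} ∈ ℝ^{h×1} such that every column of W^{(l)} has ℓ1-norm at most B^{(l)} for l = 0, …, T+1, set X_T = σ(σ(⋯σ(X W^{(0)}) W^{(1)} ⋯) W^{(T-1)}) (σ applied entrywise, T layers) and f = (X_T + Σ_{k=1}^{L-1} L γ^k Ā^k X_T (W^{(T)})^k + γ^L Ā^L X_T (W^{(T)})^L) W^{(T+1)} ∈ ℝ^N. Let ε be a transductive Rademacher vector with parameter p₀ = MU/(M+U)². Then E_ε[ sup over all admissible weight tuples of |⟨ε, f⟩| ] ≤ C' B^{(T+1)} [ 2^T (∏_{l=0}^{T-1} B^{(l)}) √(2MU/(M+U)²)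 (1 + Σ_{k=1}^{L-1} (B^{(T)})^k L γ^k Σ_{j=1}^N |λ_j|^k + γ^L (B^{(T)})^L Σ_{j=1}^N |λ_j|^L) ‖X‖_F + (Σ_{k=1}^{L-1} (B^{(T)})^k L γ^k Σ_{j=1}^N |λ_j|^k + γ^L (B^{(T)})^L Σ_{j=1}^N |λ_j|^L) √N R ]. -/

import Mathlib

open Finset

/-- Expectation with respect to a transductive Rademacher vector
`ε ∈ ℝ^N` with i.i.d. coordinates: `P(ε_i = 1) = P(ε_i = -1) = p`,
`P(ε_i = 0) = 1 - 2p`. -/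
noncomputable def tExp (N : ℕ) (p : ℝ) (f : (Fin N → ℝ) → ℝ) : ℝ :=
  ∑ s : Fin N → Fin 3,
    (∏ i, (![p, p, 1 - 2 * p] : Fin 3 → ℝ) (s i)) *
      f (fun i => (![(1 : ℝ), -1, 0]) (s i))

/-- Frobenius norm of a real matrix. -/
noncomputable def frob {m n : ℕ} (X : Matrix (Fin m) (Fin n) ℝ) : ℝ :=
  Real.sqrt (∑ i, ∑ j, (X i j) ^ 2)

/-- `mlp σ X W0 Ws t` is the output of a `(t+1)`-layer MLP with entrywise
activation `σ`: layer `0` is `σ(X W0)`, layer `k+1` multiplies by `Ws k`. -/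
noncomputable def mlp {N q h : ℕ} (σ : ℝ → ℝ) (X : Matrix (Fin N) (Fin q) ℝ)
    (W0 : Matrix (Fin q) (Fin h) ℝ) (Ws : ℕ → Matrix (Fin h) (Fin h) ℝ) :
    ℕ → Matrix (Fin N) (Fin h) ℝ
  | 0 => Matrix.of fun i j => σ ((X * W0) i j)
  | (k + 1) => Matrix.of fun i j => σ ((mlp σ X W0 Ws k * Ws k) i j)

open Matrix

section Expectation

variable {N : ℕ} {p : ℝ}

theorem tExp_add (f g : (Fin N → ℝ) → ℝ) :
    tExp N p (fun ε => f ε + g ε) = tExp N p f + tExp N p g := by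
  simp only [tExp, mul_add, sum_add_distrib]

theorem tExp_const_mul (c : ℝ) (f : (Fin N → ℝ) → ℝ) :
    tExp N p (fun ε => c * f ε) = c * tExp N p f := by
  simp only [tExp, mul_sum]
  exact sum_congr rfl fun s _ => by ring

theorem tExp_sum {ι : Type*} (t : Finset ι) (f : ι → (Fin N → ℝ) → ℝ) :
    tExp N p (fun ε => ∑ k ∈ t, f k ε) = ∑ k ∈ t, tExp N p (f k) := by
  simp only [tExp, mul_sum]
  exact sum_comm

theorem tExp_mono (hp0 : 0 ≤ p) (hp1 : p ≤ 1 / 2) {f g : (Fin N → ℝ) → ℝ}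
    (hfg : ∀ ε, f ε ≤ g ε) : tExp N p f ≤ tExp N p g := by
  refine sum_le_sum fun s _ => mul_le_mul_of_nonneg_left (hfg _) (prod_nonneg fun i _ => ?_)
  generalize s i = k
  fin_cases k <;> simp <;> linarith

/-- Expectation of a function of a single coordinate. -/
theorem tExp_coord (n : Fin N) (g : ℝ → ℝ) :
    tExp N p (fun ε => g (ε n)) = p * g 1 + p * g (-1) + (1 - 2 * p) * g 0 := by
  have h := prod_univ_sum (fun _ : Fin N => (univ : Finset (Fin 3)))
    (fun i k => (![p, p, 1 - 2 * p] : Fin 3 → ℝ) k *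
      if i = n then g ((![(1 : ℝ), -1, 0]) k) else 1)
  rw [Fintype.piFinset_univ] at h
  simp only [prod_mul_distrib, prod_ite_eq', mem_univ, if_true] at h
  rw [tExp, ← h, prod_eq_single n]
  · simp [Fin.sum_univ_three]
  · intro i _ hi
    simp [Fin.sum_univ_three, hi]
    ring
  · simp

theorem tExp_one : tExp N p (fun _ => 1) = 1 := by
  have h := prod_univ_sum (fun _ : Fin N => (univ : Finset (Fin 3)))
    (fun _ k => (![p, p, 1 - 2 * p] : Fin 3 → ℝ) k)
  rw [Fintype.piFinset_univ] at h
  simp only [tExp, mul_one]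
  rw [← h]
  refine prod_eq_one fun i _ => ?_
  simp [Fin.sum_univ_three]
  ring

/-- The law of a transductive Rademacher vector is invariant under sign changes. -/
theorem tExp_sign (τ : Fin N → ℝ) (hτ : ∀ n, τ n = 1 ∨ τ n = -1) (f : (Fin N → ℝ) → ℝ) :
    tExp N p (fun ε => f (fun n => τ n * ε n)) = tExp N p f := by
  classical
  let e : (Fin N → Fin 3) ≃ (Fin N → Fin 3) :=
    Equiv.piCongrRight fun n => if τ n = 1 then Equiv.refl _ else Equiv.swap 0 1
  refine Fintype.sum_equiv e _ _ fun s => ?_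
  have hval : ∀ n, (![(1 : ℝ), -1, 0]) (e s n) = τ n * (![(1 : ℝ), -1, 0]) (s n) := by
    intro n
    simp only [e, Equiv.piCongrRight_apply, Pi.map_apply]
    generalize s n = k
    rcases hτ n with h | h
    · simp [h]
    · rw [if_neg (by rw [h]; norm_num), h]
      fin_cases k <;> simp [Equiv.swap_apply_def]
  have hwt : ∀ n, (![p, p, 1 - 2 * p] : Fin 3 → ℝ) (e s n) = ![p, p, 1 - 2 * p] (s n) := by
    intro n
    simp only [e, Equiv.piCongrRight_apply, Pi.map_apply]
    generalize s n = k
    split_ifs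
    · rfl
    · fin_cases k <;> simp [Equiv.swap_apply_def]
  simp only [hval, hwt]

theorem tExp_mul_coord (n m : Fin N) :
    tExp N p (fun ε => ε n * ε m) = if n = m then 2 * p else 0 := by
  split_ifs with h
  · subst h
    rw [tExp_coord n fun x => x * x]
    ring
  · have h1 := tExp_sign (p := p) (fun i => if i = n then -1 else 1)
      (fun i => by by_cases hi : i = n <;> simp [hi]) (fun ε => ε n * ε m)
    simp only [if_true, if_neg (Ne.symm h), one_mul] at h1
    have h2 := tExp_const_mul (p := p) (-1) (fun ε : Fin N → ℝ => ε n * ε m)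
    simp only [neg_mul, one_mul] at h1 h2
    linarith

theorem tExp_dotProduct_sq (a : Fin N → ℝ) :
    tExp N p (fun ε => (ε ⬝ᵥ a) ^ 2) = 2 * p * ∑ n, a n ^ 2 := by
  have h : (fun ε : Fin N → ℝ => (ε ⬝ᵥ a) ^ 2) =
      fun ε => ∑ n, ∑ m, (a n * a m) * (ε n * ε m) := by
    funext ε
    rw [sq, dotProduct, sum_mul_sum]
    exact sum_congr rfl fun n _ => sum_congr rfl fun m _ => by ring
  rw [h, tExp_sum, mul_sum]
  refine sum_congr rfl fun n _ => ?_
  rw [tExp_sum]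
  simp only [tExp_const_mul, tExp_mul_coord, mul_ite, mul_zero, sum_ite_eq, mem_univ, if_true]
  ring

theorem tExp_le_sqrt (hp0 : 0 ≤ p) (hp1 : p ≤ 1 / 2) (f : (Fin N → ℝ) → ℝ) :
    tExp N p f ≤ Real.sqrt (tExp N p fun ε => f ε ^ 2) := by
  set m := tExp N p f with hm
  apply Real.le_sqrt_of_sq_le
  have h := tExp_mono (N := N) hp0 hp1 (f := fun ε => 2 * m * f ε + (-m ^ 2) * 1)
    (g := fun ε => f ε ^ 2) fun ε => by nlinarith [sq_nonneg (f ε - m)]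
  rw [tExp_add, tExp_const_mul, tExp_const_mul, tExp_one, ← hm] at h
  linarith

theorem tExp_abs_dotProduct_le (hp0 : 0 ≤ p) (hp1 : p ≤ 1 / 2) (a : Fin N → ℝ) :
    tExp N p (fun ε => |ε ⬝ᵥ a|) ≤ Real.sqrt (2 * p * ∑ n, a n ^ 2) := by
  have h := tExp_le_sqrt hp0 hp1 fun ε : Fin N → ℝ => |ε ⬝ᵥ a|
  simpa only [sq_abs, tExp_dotProduct_sq] using h

end Expectation

section Contraction

variable {N : ℕ} {p : ℝ} {ι : Type*}

theorem abs_dotProduct_le {v : Fin N → ℝ} {K : ℝ} (hv : ∀ n, |v n| ≤ K) (ε : Fin N → ℝ) :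
    |ε ⬝ᵥ v| ≤ (∑ n, |ε n|) * K := by
  rw [dotProduct, sum_mul]
  refine (abs_sum_le_sum_abs _ _).trans (sum_le_sum fun n _ => ?_)
  rw [abs_mul]
  exact mul_le_mul_of_nonneg_left (hv n) (abs_nonneg _)

theorem bddAbove_abs_dotProduct {v : ι → Fin N → ℝ} {K : ℝ} (hv : ∀ x n, |v x n| ≤ K)
    (ε : Fin N → ℝ) : BddAbove (Set.range fun x => |ε ⬝ᵥ v x|) :=
  ⟨_, by rintro _ ⟨x, rfl⟩; exact abs_dotProduct_le (hv x) ε⟩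

theorem bddAbove_dotProduct {v : ι → Fin N → ℝ} {K : ℝ} (hv : ∀ x n, |v x n| ≤ K)
    (ε : Fin N → ℝ) : BddAbove (Set.range fun x => ε ⬝ᵥ v x) :=
  ⟨_, by rintro _ ⟨x, rfl⟩; exact (le_abs_self _).trans (abs_dotProduct_le (hv x) ε)⟩

/-- Replacing one coordinate of the index set by a contraction of it does not increase the
Rademacher average. -/
theorem tExp_iSup_le_of_coord [Nonempty ι] (hp0 : 0 ≤ p) (hp1 : p ≤ 1 / 2)
    {u v : ι → Fin N → ℝ} {K : ℝ} (hu : ∀ x n, |u x n| ≤ K) (i : Fin N)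
    (heq : ∀ x n, n ≠ i → v x n = u x n)
    (hcon : ∀ x y, |v x i - v y i| ≤ |u x i - u y i|) :
    tExp N p (fun ε => ⨆ x, ε ⬝ᵥ v x) ≤ tExp N p (fun ε => ⨆ x, ε ⬝ᵥ u x) := by
  set τ : Fin N → ℝ := fun n => if n = i then -1 else 1 with hτ
  have hτ' : ∀ n, τ n = 1 ∨ τ n = -1 := fun n => by by_cases h : n = i <;> simp [hτ, h]
  have hv2 := tExp_sign (p := p) τ hτ' (fun ε => ⨆ x, ε ⬝ᵥ v x)
  have hu2 := tExp_sign (p := p) τ hτ' (fun ε => ⨆ x, ε ⬝ᵥ u x)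
  have key := tExp_mono (N := N) hp0 hp1
    (f := fun ε => (⨆ x, ε ⬝ᵥ v x) + ⨆ x, (fun n => τ n * ε n) ⬝ᵥ v x)
    (g := fun ε => (⨆ x, ε ⬝ᵥ u x) + ⨆ x, (fun n => τ n * ε n) ⬝ᵥ u x) ?_
  · rw [tExp_add, tExp_add, hv2, hu2] at key
    linarith
  intro ε
  have hsplit : ∀ (e a : Fin N → ℝ), e ⬝ᵥ a = e i * a i + ∑ n ∈ univ.erase i, e n * a n :=
    fun e a => (add_sum_erase _ _ (mem_univ i)).symm
  have hrest : ∀ a b : Fin N → ℝ, (∀ n, n ≠ i → a n = b n) →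
      ∑ n ∈ univ.erase i, (τ n * ε n) * a n = ∑ n ∈ univ.erase i, ε n * b n := by
    intro a b hab
    refine sum_congr rfl fun n hn => ?_
    simp [hτ, ne_of_mem_erase hn, hab n (ne_of_mem_erase hn)]
  have hrest' : ∀ a b : Fin N → ℝ, (∀ n, n ≠ i → a n = b n) →
      ∑ n ∈ univ.erase i, ε n * a n = ∑ n ∈ univ.erase i, ε n * b n := fun a b hab =>
    sum_congr rfl fun n hn => by rw [hab n (ne_of_mem_erase hn)]
  have hτi : τ i = -1 := by simp [hτ]
  have hle : ∀ x, ε ⬝ᵥ u x ≤ ⨆ x, ε ⬝ᵥ u x := le_ciSup (bddAbove_dotProduct hu ε)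
  have hle' : ∀ x, (fun n => τ n * ε n) ⬝ᵥ u x ≤ ⨆ x, (fun n => τ n * ε n) ⬝ᵥ u x :=
    le_ciSup (bddAbove_dotProduct hu _)
  refine ciSup_add_ciSup_le fun x y => ?_
  have hb : ε i * (v x i - v y i) ≤ |ε i * (u x i - u y i)| := by
    refine (le_abs_self _).trans ?_
    rw [abs_mul, abs_mul]
    exact mul_le_mul_of_nonneg_left (hcon x y) (abs_nonneg _)
  have h1 := add_le_add (hle x) (hle' y)
  have h2 := add_le_add (hle y) (hle' x)
  simp only [hsplit _ (u _), hsplit _ (v _), hτi, hrest _ (u _) (heq _),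
    hrest' _ (u _) (heq _), hrest (u _) (u _) fun _ _ => rfl] at h1 h2 ⊢
  rcases abs_cases (ε i * (u x i - u y i)) with ⟨h, _⟩ | ⟨h, _⟩ <;> rw [h] at hb <;> linarith

/-- Contraction principle for suprema without absolute values. -/
theorem tExp_iSup_contraction [Nonempty ι] (hp0 : 0 ≤ p) (hp1 : p ≤ 1 / 2)
    {σ : ℝ → ℝ} (hσ : ∀ x y, |σ x - σ y| ≤ |x - y|) (hσ0 : σ 0 = 0)
    {u : ι → Fin N → ℝ} {K : ℝ} (hu : ∀ x n, |u x n| ≤ K) :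
    tExp N p (fun ε => ⨆ x, ε ⬝ᵥ (fun n => σ (u x n)))
      ≤ tExp N p (fun ε => ⨆ x, ε ⬝ᵥ u x) := by
  classical
  have habs : ∀ x, |σ x| ≤ |x| := fun x => by simpa [hσ0] using hσ x 0
  have main : ∀ I : Finset (Fin N),
      tExp N p (fun ε => ⨆ x, ε ⬝ᵥ (fun n => if n ∈ I then σ (u x n) else u x n))
        ≤ tExp N p (fun ε => ⨆ x, ε ⬝ᵥ u x) := by
    intro I
    induction I using Finset.induction_on with
    | empty => simp
    | insert i I hi ih =>
      refine le_trans (tExp_iSup_le_of_coord hp0 hp1 (K := K) (fun x n => ?_) i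
        (fun x n hn => ?_) fun x y => ?_) ih
      · split_ifs
        · exact (habs _).trans (hu x n)
        · exact hu x n
      · simp [hn]
      · simpa [hi] using hσ _ _
  simpa using main univ

/-- Contraction principle for suprema of absolute values. -/
theorem tExp_iSup_abs_contraction (hp0 : 0 ≤ p) (hp1 : p ≤ 1 / 2)
    {σ : ℝ → ℝ} (hσ : ∀ x y, |σ x - σ y| ≤ |x - y|) (hσ0 : σ 0 = 0)
    {u : ι → Fin N → ℝ} {K : ℝ} (hu : ∀ x n, |u x n| ≤ K) (x₀ : ι) (hx₀ : u x₀ = 0) :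
    tExp N p (fun ε => ⨆ x, |ε ⬝ᵥ (fun n => σ (u x n))|)
      ≤ 2 * tExp N p (fun ε => ⨆ x, |ε ⬝ᵥ u x|) := by
  have : Nonempty ι := ⟨x₀⟩
  have habs : ∀ x, |σ x| ≤ |x| := fun x => by simpa [hσ0] using hσ x 0
  have hbdd := bddAbove_dotProduct (v := fun x n => σ (u x n)) fun x n =>
    (habs _).trans (hu x n)
  have hnonneg : ∀ ε : Fin N → ℝ, 0 ≤ ⨆ x, ε ⬝ᵥ (fun n => σ (u x n)) := fun ε =>
    le_ciSup_of_le (hbdd ε) x₀ (by simp [hx₀, hσ0, dotProduct])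
  have hsym := tExp_sign (p := p) (fun _ => -1) (fun _ => Or.inr rfl)
    (fun ε : Fin N → ℝ => ⨆ x, ε ⬝ᵥ (fun n => σ (u x n)))
  have h1 := tExp_mono (N := N) hp0 hp1
    (f := fun ε => ⨆ x, |ε ⬝ᵥ (fun n => σ (u x n))|)
    (g := fun ε => (⨆ x, ε ⬝ᵥ (fun n => σ (u x n))) +
      ⨆ x, (fun n => -1 * ε n) ⬝ᵥ (fun n => σ (u x n))) fun ε => by
    refine ciSup_le fun x => ?_
    have ha := le_ciSup (hbdd ε) x
    have hb := le_ciSup (hbdd fun n => -1 * ε n) x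
    have hneg : (fun n => -1 * ε n) ⬝ᵥ (fun n => σ (u x n)) = -(ε ⬝ᵥ fun n => σ (u x n)) := by
      simp [dotProduct]
    have := hnonneg ε
    have := hnonneg fun n => -1 * ε n
    rw [hneg] at hb
    rcases abs_cases (ε ⬝ᵥ fun n => σ (u x n)) with ⟨h, _⟩ | ⟨h, _⟩ <;> linarith
  have h2 := tExp_iSup_contraction hp0 hp1 hσ hσ0 hu
  have h3 := tExp_mono (N := N) hp0 hp1 (f := fun ε => ⨆ x, ε ⬝ᵥ u x)
    (g := fun ε => ⨆ x, |ε ⬝ᵥ u x|) fun ε =>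
      ciSup_mono (bddAbove_abs_dotProduct hu ε) fun x => le_abs_self _
  rw [tExp_add, hsym] at h1
  linarith

end Contraction

section Layers

variable {N q h : ℕ} {p : ℝ}

/-- Supremum of `|⟨ε, v⟩|` over `v ∈ S`. -/
noncomputable def absSup (S : Set (Fin N → ℝ)) (ε : Fin N → ℝ) : ℝ :=
  ⨆ v : S, |ε ⬝ᵥ (v : Fin N → ℝ)|

/-- Finite linear combinations of elements of `S` whose coefficients have `ℓ¹`-norm at most `b`. -/
def l1Comb (S : Set (Fin N → ℝ)) (b : ℝ) : Set (Fin N → ℝ) :=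
  {v | ∃ (m : ℕ) (g : Fin m → Fin N → ℝ) (w : Fin m → ℝ),
    (∀ c, g c ∈ S) ∧ ∑ c, |w c| ≤ b ∧ v = ∑ c, w c • g c}

/-- The columns that the first `t` layers of an MLP with input `X` and column-wise `ℓ¹` weight
bounds `B` can produce. -/
def layerClass (σ : ℝ → ℝ) (X : Matrix (Fin N) (Fin q) ℝ) (B : ℕ → ℝ) : ℕ → Set (Fin N → ℝ)
  | 0 => Set.range Xᵀ
  | t + 1 => (fun v n => σ (v n)) '' l1Comb (layerClass σ X B t) (B t)

/-- Uniform boundedness of all coordinates of all elements of `S`. -/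
def CoordBounded (S : Set (Fin N → ℝ)) : Prop :=
  ∃ K, 0 ≤ K ∧ ∀ v ∈ S, ∀ n, |v n| ≤ K

theorem absSup_nonneg (S : Set (Fin N → ℝ)) (ε : Fin N → ℝ) : 0 ≤ absSup S ε :=
  Real.iSup_nonneg fun _ => abs_nonneg _

theorem CoordBounded.abs_dotProduct_le_absSup {S : Set (Fin N → ℝ)} (hS : CoordBounded S)
    {v : Fin N → ℝ} (hv : v ∈ S) (ε : Fin N → ℝ) : |ε ⬝ᵥ v| ≤ absSup S ε := by
  obtain ⟨K, _, hK⟩ := hS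
  exact le_ciSup (bddAbove_abs_dotProduct (v := fun x : S => (x : Fin N → ℝ))
    (fun x => hK x x.2) ε) ⟨v, hv⟩

theorem abs_sum_mul_le {m : ℕ} {w a : Fin m → ℝ} {b K : ℝ} (hw : ∑ c, |w c| ≤ b)
    (hK : 0 ≤ K) (ha : ∀ c, |a c| ≤ K) : |∑ c, w c * a c| ≤ b * K := by
  refine (abs_sum_le_sum_abs _ _).trans (le_trans ?_ (mul_le_mul_of_nonneg_right hw hK))
  rw [sum_mul]
  refine sum_le_sum fun c _ => ?_
  rw [abs_mul]
  exact mul_le_mul_of_nonneg_left (ha c) (abs_nonneg _)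

theorem zero_mem_l1Comb (S : Set (Fin N → ℝ)) {b : ℝ} (hb : 0 ≤ b) : 0 ∈ l1Comb S b :=
  ⟨0, Fin.elim0, Fin.elim0, fun c => c.elim0, by simpa using hb, by simp⟩

theorem CoordBounded.l1Comb {S : Set (Fin N → ℝ)} (hS : CoordBounded S) {b : ℝ} (hb : 0 ≤ b) :
    CoordBounded (l1Comb S b) := by
  obtain ⟨K, hK, hS⟩ := hS
  refine ⟨b * K, mul_nonneg hb hK, ?_⟩
  rintro _ ⟨m, g, w, hg, hw, rfl⟩ n
  simpa using abs_sum_mul_le hw hK fun c => hS _ (hg c) n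

theorem absSup_l1Comb_le {S : Set (Fin N → ℝ)} (hS : CoordBounded S) {b : ℝ} (hb : 0 ≤ b)
    (ε : Fin N → ℝ) : absSup (l1Comb S b) ε ≤ b * absSup S ε := by
  refine Real.iSup_le ?_ (mul_nonneg hb (absSup_nonneg S ε))
  rintro ⟨_, m, g, w, hg, hw, rfl⟩
  simpa [dotProduct_sum, dotProduct_smul] using
    abs_sum_mul_le hw (absSup_nonneg S ε) fun c => hS.abs_dotProduct_le_absSup (hg c) ε

theorem tExp_absSup_image_le (hp0 : 0 ≤ p) (hp1 : p ≤ 1 / 2) {σ : ℝ → ℝ}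
    (hσ : ∀ x y, |σ x - σ y| ≤ |x - y|) (hσ0 : σ 0 = 0) {S : Set (Fin N → ℝ)}
    (hS : CoordBounded S) (h0 : 0 ∈ S) :
    tExp N p (absSup ((fun v n => σ (v n)) '' S)) ≤ 2 * tExp N p (absSup S) := by
  obtain ⟨K, hK0, hK⟩ := hS
  refine le_trans (tExp_mono hp0 hp1 fun ε => ?_)
    (tExp_iSup_abs_contraction hp0 hp1 hσ hσ0 (u := fun x : S => (x : Fin N → ℝ))
      (fun x => hK x x.2) ⟨0, h0⟩ rfl)
  refine Real.iSup_le ?_ (Real.iSup_nonneg fun _ => abs_nonneg _)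
  rintro ⟨_, v, hv, rfl⟩
  exact le_ciSup (bddAbove_abs_dotProduct (v := fun (x : S) n => σ ((x : Fin N → ℝ) n))
    (fun x n => le_trans (by simpa [hσ0] using hσ ((x : Fin N → ℝ) n) 0) (hK x x.2 n)) ε) ⟨v, hv⟩

variable {σ : ℝ → ℝ} {X : Matrix (Fin N) (Fin q) ℝ} {B : ℕ → ℝ}

theorem coordBounded_layerClass (hσ : ∀ x y, |σ x - σ y| ≤ |x - y|) (hσ0 : σ 0 = 0) :
    ∀ t, (∀ l < t, 0 ≤ B l) → CoordBounded (layerClass σ X B t) := by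
  intro t
  induction t with
  | zero =>
    intro _
    refine ⟨∑ j, ∑ n, |X n j|, sum_nonneg fun _ _ => sum_nonneg fun _ _ => abs_nonneg _, ?_⟩
    rintro _ ⟨j, rfl⟩ n
    exact (single_le_sum (f := fun n => |X n j|) (fun _ _ => abs_nonneg _) (mem_univ n)).trans
      (single_le_sum (f := fun j => ∑ n, |X n j|)
        (fun _ _ => sum_nonneg fun _ _ => abs_nonneg _) (mem_univ j))
  | succ t ih =>
    intro hB
    obtain ⟨K, hK0, hK⟩ := (ih fun l hl => hB l (by omega)).l1Comb (hB t (by omega))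
    refine ⟨K, hK0, ?_⟩
    rintro _ ⟨v, hv, rfl⟩ n
    exact le_trans (by simpa [hσ0] using hσ (v n) 0) (hK v hv n)

theorem tExp_absSup_range_le (hp0 : 0 ≤ p) (hp1 : p ≤ 1 / 2) :
    tExp N p (absSup (Set.range Xᵀ)) ≤ Real.sqrt (2 * p) * frob X := by
  have h1 := tExp_mono (N := N) hp0 hp1 (f := absSup (Set.range Xᵀ))
    (g := fun ε => Real.sqrt (∑ j, (ε ⬝ᵥ Xᵀ j) ^ 2)) fun ε => by
    refine Real.iSup_le ?_ (Real.sqrt_nonneg _)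
    rintro ⟨_, j, rfl⟩
    exact Real.abs_le_sqrt (single_le_sum (f := fun j => (ε ⬝ᵥ Xᵀ j) ^ 2)
      (fun _ _ => sq_nonneg _) (mem_univ j))
  refine (h1.trans (tExp_le_sqrt hp0 hp1 _)).trans_eq ?_
  have h2 : ∀ ε : Fin N → ℝ, Real.sqrt (∑ j, (ε ⬝ᵥ Xᵀ j) ^ 2) ^ 2 = ∑ j, (ε ⬝ᵥ Xᵀ j) ^ 2 :=
    fun ε => Real.sq_sqrt (sum_nonneg fun _ _ => sq_nonneg _)
  simp only [h2, tExp_sum, tExp_dotProduct_sq]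
  rw [frob, ← Real.sqrt_mul (by linarith), ← mul_sum, sum_comm]
  rfl

theorem tExp_absSup_layerClass_le (hp0 : 0 ≤ p) (hp1 : p ≤ 1 / 2)
    (hσ : ∀ x y, |σ x - σ y| ≤ |x - y|) (hσ0 : σ 0 = 0) :
    ∀ t, (∀ l < t, 0 ≤ B l) → tExp N p (absSup (layerClass σ X B t)) ≤
      2 ^ t * (∏ l ∈ range t, B l) * Real.sqrt (2 * p) * frob X := by
  intro t
  induction t with
  | zero =>
    intro _
    rw [pow_zero, range_zero, prod_empty, one_mul, one_mul]
    exact tExp_absSup_range_le hp0 hp1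
  | succ t ih =>
    intro hB
    have hB' : ∀ l < t, 0 ≤ B l := fun l hl => hB l (by omega)
    have hbt : 0 ≤ B t := hB t (by omega)
    have hbd := coordBounded_layerClass (X := X) hσ hσ0 t hB'
    have h1 := tExp_absSup_image_le hp0 hp1 hσ hσ0 (hbd.l1Comb hbt) (zero_mem_l1Comb _ hbt)
    have h2 := tExp_mono (N := N) hp0 hp1 (absSup_l1Comb_le hbd hbt)
    rw [tExp_const_mul] at h2
    have h3 := mul_le_mul_of_nonneg_left (ih hB') hbt
    refine h1.trans ((mul_le_mul_of_nonneg_left (h2.trans h3) zero_le_two).trans_eq ?_)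
    rw [prod_range_succ, pow_succ]
    ring

theorem mlp_col_mem_layerClass {W0 : Matrix (Fin q) (Fin h) ℝ}
    {Ws : ℕ → Matrix (Fin h) (Fin h) ℝ} (hW0 : ∀ c, ∑ r, |W0 r c| ≤ B 0) :
    ∀ t, (∀ l < t, ∀ c, ∑ r, |Ws l r c| ≤ B (l + 1)) →
      ∀ c, (mlp σ X W0 Ws t)ᵀ c ∈ layerClass σ X B (t + 1) := by
  intro t
  induction t with
  | zero =>
    intro _ c
    refine ⟨_, ⟨q, Xᵀ, fun r => W0 r c, fun j => ⟨j, rfl⟩, hW0 c, rfl⟩, ?_⟩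
    funext n
    simp [mlp, mul_apply, mul_comm]
  | succ t ih =>
    intro hWs c
    refine ⟨_, ⟨h, (mlp σ X W0 Ws t)ᵀ, fun r => Ws t r c,
      ih fun l hl => hWs l (by omega), hWs t (by omega) c, rfl⟩, ?_⟩
    funext n
    simp [mlp, mul_apply, mul_comm]

theorem abs_mlp_le {R : ℝ} (hR : ∀ t, |σ t| ≤ R) (W0 : Matrix (Fin q) (Fin h) ℝ)
    (Ws : ℕ → Matrix (Fin h) (Fin h) ℝ) (t : ℕ) (n : Fin N) (c : Fin h) :
    |mlp σ X W0 Ws t n c| ≤ R := by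
  cases t <;> exact hR _

end Layers

section Propagation

variable {N h : ℕ} {p : ℝ}

theorem mulVec_eq_sum_smul_transpose (Y : Matrix (Fin N) (Fin h) ℝ) (z : Fin h → ℝ) :
    Y *ᵥ z = ∑ c, z c • Yᵀ c := by
  funext n
  simp [mulVec, dotProduct, mul_comm]

theorem sum_abs_pow_mulVec_le {W : Matrix (Fin h) (Fin h) ℝ} {w : Fin h → ℝ} {b b' : ℝ}
    (hb : 0 ≤ b) (hW : ∀ c, ∑ r, |W r c| ≤ b) (hw : ∑ r, |w r| ≤ b') (k : ℕ) :
    ∑ r, |(W ^ k *ᵥ w) r| ≤ b ^ k * b' := by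
  induction k with
  | zero => simpa using hw
  | succ k ih =>
    rw [pow_succ', ← mulVec_mulVec, pow_succ', mul_assoc]
    set z := W ^ k *ᵥ w
    calc ∑ r, |(W *ᵥ z) r| ≤ ∑ r, ∑ c, |W r c| * |z c| := by
          refine sum_le_sum fun r _ => ?_
          simp only [← abs_mul]
          exact abs_sum_le_sum_abs (fun c => W r c * z c) univ
      _ = ∑ c, (∑ r, |W r c|) * |z c| := by
          rw [sum_comm]
          simp only [sum_mul]
      _ ≤ ∑ c, b * |z c| :=
          sum_le_sum fun c _ => mul_le_mul_of_nonneg_right (hW c) (abs_nonneg _)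
      _ ≤ b * (b ^ k * b') := by
          rw [← mul_sum]
          exact mul_le_mul_of_nonneg_left ih hb

variable {A : Matrix (Fin N) (Fin N) ℝ} (hA : A.IsHermitian)

theorem sum_sq_eigenvectorBasis (j : Fin N) : ∑ n, (hA.eigenvectorBasis j n) ^ 2 = 1 := by
  have h := hA.eigenvectorBasis.orthonormal.1 j
  rw [EuclideanSpace.norm_eq, Real.sqrt_eq_one] at h
  simpa using h

theorem dotProduct_pow_mulVec (k : ℕ) (ε y : Fin N → ℝ) :
    ε ⬝ᵥ (A ^ k *ᵥ y) = ∑ j, hA.eigenvalues j ^ k * (ε ⬝ᵥ ⇑(hA.eigenvectorBasis j)) *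
      (⇑(hA.eigenvectorBasis j) ⬝ᵥ y) := by
  have hpow : ∀ j, A ^ k *ᵥ ⇑(hA.eigenvectorBasis j) =
      hA.eigenvalues j ^ k • ⇑(hA.eigenvectorBasis j) := by
    intro j
    induction k with
    | zero => simp
    | succ k ih =>
      rw [pow_succ', ← mulVec_mulVec, ih, mulVec_smul, hA.mulVec_eigenvectorBasis, smul_smul,
        pow_succ]
  have hy : y = ∑ j, (⇑(hA.eigenvectorBasis j) ⬝ᵥ y) • ⇑(hA.eigenvectorBasis j) := by
    have h := hA.eigenvectorBasis.sum_repr' (WithLp.toLp 2 y)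
    have h' := congrArg (WithLp.ofLp) h
    rw [WithLp.ofLp_sum] at h'
    refine h'.symm.trans (sum_congr rfl fun j _ => ?_)
    rw [WithLp.ofLp_smul, EuclideanSpace.inner_eq_star_dotProduct]
    simp [dotProduct_comm]
  conv_lhs => rw [hy]
  rw [mulVec_sum, dotProduct_sum]
  refine sum_congr rfl fun j _ => ?_
  rw [mulVec_smul, hpow, dotProduct_smul, dotProduct_smul, smul_eq_mul, smul_eq_mul]
  ring

theorem abs_eigenvectorBasis_dotProduct_le {y : Fin N → ℝ} {R : ℝ} (hR : 0 ≤ R)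
    (hy : ∀ n, |y n| ≤ R) (j : Fin N) :
    |⇑(hA.eigenvectorBasis j) ⬝ᵥ y| ≤ Real.sqrt N * R := by
  apply abs_le_of_sq_le_sq _ (by positivity)
  have h := sum_mul_sq_le_sq_mul_sq univ (⇑(hA.eigenvectorBasis j)) y
  rw [sum_sq_eigenvectorBasis, one_mul] at h
  rw [mul_pow, Real.sq_sqrt (Nat.cast_nonneg N)]
  refine h.trans ((sum_le_sum fun n _ => sq_le_sq' (abs_le.mp (hy n)).1
    (abs_le.mp (hy n)).2).trans_eq ?_)
  simp

/-- Spectral functional controlling `|⟨ε, A ^ k y⟩|` for bounded `y`. -/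
noncomputable def spectralSum (k : ℕ) (ε : Fin N → ℝ) : ℝ :=
  ∑ j, |hA.eigenvalues j| ^ k * |ε ⬝ᵥ ⇑(hA.eigenvectorBasis j)|

theorem spectralSum_nonneg (k : ℕ) (ε : Fin N → ℝ) : 0 ≤ spectralSum hA k ε :=
  sum_nonneg fun _ _ => by positivity

theorem abs_dotProduct_pow_mulVec_le {y : Fin N → ℝ} {R : ℝ} (hR : 0 ≤ R)
    (hy : ∀ n, |y n| ≤ R) (k : ℕ) (ε : Fin N → ℝ) :
    |ε ⬝ᵥ (A ^ k *ᵥ y)| ≤ spectralSum hA k ε * (Real.sqrt N * R) := by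
  rw [dotProduct_pow_mulVec hA, spectralSum, sum_mul]
  refine (abs_sum_le_sum_abs _ _).trans (sum_le_sum fun j _ => ?_)
  rw [abs_mul, abs_mul, abs_pow]
  exact mul_le_mul_of_nonneg_left (abs_eigenvectorBasis_dotProduct_le hA hR hy j) (by positivity)

theorem tExp_spectralSum_le (hp0 : 0 ≤ p) (hp1 : p ≤ 1 / 2) (k : ℕ) :
    tExp N p (spectralSum hA k) ≤ ∑ j, |hA.eigenvalues j| ^ k := by
  have h : tExp N p (spectralSum hA k) =
      ∑ j, |hA.eigenvalues j| ^ k * tExp N p fun ε => |ε ⬝ᵥ ⇑(hA.eigenvectorBasis j)| := by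
    simp only [← tExp_const_mul, ← tExp_sum]
    rfl
  rw [h]
  refine sum_le_sum fun j _ => mul_le_of_le_one_right (by positivity) ?_
  refine (tExp_abs_dotProduct_le hp0 hp1 _).trans ?_
  rw [sum_sq_eigenvectorBasis, Real.sqrt_le_one]
  linarith

theorem abs_dotProduct_pow_mul_mul_pow_le {Y : Matrix (Fin N) (Fin h) ℝ} {R : ℝ} (hR : 0 ≤ R)
    (hY : ∀ n c, |Y n c| ≤ R) {W : Matrix (Fin h) (Fin h) ℝ} {w : Fin h → ℝ} {b b' : ℝ}
    (hb : 0 ≤ b) (hW : ∀ c, ∑ r, |W r c| ≤ b) (hw : ∑ r, |w r| ≤ b') (k : ℕ)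
    (ε : Fin N → ℝ) :
    |ε ⬝ᵥ ((A ^ k * Y * W ^ k) *ᵥ w)| ≤
      b ^ k * b' * (spectralSum hA k ε * (Real.sqrt N * R)) := by
  have h : ε ⬝ᵥ ((A ^ k * Y * W ^ k) *ᵥ w) =
      ∑ c, (W ^ k *ᵥ w) c * (ε ⬝ᵥ (A ^ k *ᵥ Yᵀ c)) := by
    rw [← mulVec_mulVec, ← mulVec_mulVec]
    rw [mulVec_eq_sum_smul_transpose Y, mulVec_sum, dotProduct_sum]
    refine sum_congr rfl fun c _ => ?_
    rw [mulVec_smul, dotProduct_smul, smul_eq_mul]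
  rw [h]
  exact abs_sum_mul_le (sum_abs_pow_mulVec_le hb hW hw k)
    (mul_nonneg (spectralSum_nonneg hA k ε) (by positivity))
    fun c => abs_dotProduct_pow_mulVec_le hA hR (fun n => hY n c) k ε

end Propagation

/-- Rademacher complexity bound for the GPCN model (Theorem 1 with μ = 1). -/
theorem gpcn_rademacher_bound :
    ∃ C' : ℝ, 0 < C' ∧
      ∀ (N q h T L M U : ℕ), 0 < N → 0 < q → 0 < h → 0 < T → 0 < L → 0 < M → 0 < U →
      ∀ (X : Matrix (Fin N) (Fin q) ℝ) (A : Matrix (Fin N) (Fin N) ℝ)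
        (hA : A.IsHermitian) (σ : ℝ → ℝ) (R : ℝ),
        LipschitzWith 1 σ → σ 0 = 0 → (∀ t, |σ t| ≤ R) →
      ∀ (B : ℕ → ℝ) (γ : ℝ),
        (∀ l ≤ T + 1, 0 ≤ B l) → 0 ≤ γ →
      tExp N ((M : ℝ) * U / ((M : ℝ) + U) ^ 2) (fun ε =>
        sSup {y : ℝ | ∃ (W0 : Matrix (Fin q) (Fin h) ℝ)
            (Ws : ℕ → Matrix (Fin h) (Fin h) ℝ)
            (WT : Matrix (Fin h) (Fin h) ℝ)
            (w : Fin h → ℝ),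
          (∀ c, ∑ r, |W0 r c| ≤ B 0) ∧
          (∀ l, l < T - 1 → ∀ c, ∑ r, |Ws l r c| ≤ B (l + 1)) ∧
          (∀ c, ∑ r, |WT r c| ≤ B T) ∧
          (∑ r, |w r| ≤ B (T + 1)) ∧
          y = |∑ n, ε n *
            ((mlp σ X W0 Ws (T - 1)
                + (∑ k ∈ Finset.Icc 1 (L - 1),
                    ((L : ℝ) * γ ^ k) • (A ^ k * mlp σ X W0 Ws (T - 1) * WT ^ k))
                + γ ^ L • (A ^ L * mlp σ X W0 Ws (T - 1) * WT ^ L)).mulVec w) n|})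
      ≤ C' * B (T + 1) *
          ((2 : ℝ) ^ T * (∏ l ∈ Finset.range T, B l) *
              Real.sqrt (2 * (M : ℝ) * U / ((M : ℝ) + U) ^ 2) *
              (1 + (∑ k ∈ Finset.Icc 1 (L - 1),
                      (B T) ^ k * (L : ℝ) * γ ^ k * ∑ j, |hA.eigenvalues j| ^ k)
                 + γ ^ L * (B T) ^ L * ∑ j, |hA.eigenvalues j| ^ L) * frob X
            + ((∑ k ∈ Finset.Icc 1 (L - 1),
                    (B T) ^ k * (L : ℝ) * γ ^ k * ∑ j, |hA.eigenvalues j| ^ k)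
                 + γ ^ L * (B T) ^ L * ∑ j, |hA.eigenvalues j| ^ L) *
                Real.sqrt (N : ℝ) * R) := by
  refine ⟨1, one_pos, ?_⟩
  intro N q h T L M U _ _ _ hT _ hM _ X A hA σ R hlip hσ0 hR B γ hB hγ
  have hσ : ∀ x y, |σ x - σ y| ≤ |x - y| := fun x y => by
    simpa [Real.dist_eq] using hlip.dist_le_mul x y
  have hR0 : 0 ≤ R := (abs_nonneg _).trans (hR 0)
  have hMpos : (0 : ℝ) < M := Nat.cast_pos.mpr hM
  have hU0 : (0 : ℝ) ≤ U := Nat.cast_nonneg U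
  have hp0 : 0 ≤ (M : ℝ) * U / ((M : ℝ) + U) ^ 2 := by positivity
  have hp1 : (M : ℝ) * U / ((M : ℝ) + U) ^ 2 ≤ 1 / 2 := by
    rw [div_le_iff₀ (by positivity)]
    nlinarith
  have hp2 : 2 * (M : ℝ) * U / ((M : ℝ) + U) ^ 2 = 2 * ((M : ℝ) * U / ((M : ℝ) + U) ^ 2) := by
    ring
  rw [hp2]
  generalize (M : ℝ) * U / ((M : ℝ) + U) ^ 2 = p at hp0 hp1
  have hBT : 0 ≤ B T := hB T (by omega)
  have hBout : 0 ≤ B (T + 1) := hB (T + 1) le_rfl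
  have hBl : ∀ l < T, 0 ≤ B l := fun l hl => hB l (by omega)
  have hclass := coordBounded_layerClass (X := X) hσ hσ0 T hBl
  refine (tExp_mono hp0 hp1
    (g := fun ε => B (T + 1) * absSup (layerClass σ X B T) ε +
      ((∑ k ∈ Finset.Icc 1 (L - 1), ((L : ℝ) * γ ^ k * ((B T) ^ k * B (T + 1)) *
          (Real.sqrt N * R)) * spectralSum hA k ε) +
        (γ ^ L * ((B T) ^ L * B (T + 1)) * (Real.sqrt N * R)) * spectralSum hA L ε))
    fun ε => Real.sSup_le ?_ ?_).trans ?_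
  · rintro _ ⟨W0, Ws, WT, w, hW0, hWs, hWT, hw, rfl⟩
    obtain ⟨t, rfl⟩ : ∃ t, T = t + 1 := ⟨T - 1, by omega⟩
    simp only [Nat.add_sub_cancel] at hWs ⊢
    set Y := mlp σ X W0 Ws t with hYdef
    have hY : ∀ n c, |Y n c| ≤ R := abs_mlp_le hR W0 Ws t
    have hprop := abs_dotProduct_pow_mul_mul_pow_le hA hR0 hY hBT hWT hw
    have hfirst : |ε ⬝ᵥ (Y *ᵥ w)| ≤ B (t + 1 + 1) * absSup (layerClass σ X B (t + 1)) ε := by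
      have hcol : ε ⬝ᵥ (Y *ᵥ w) = ∑ c, w c * (ε ⬝ᵥ Yᵀ c) := by
        simp only [mulVec_eq_sum_smul_transpose Y, dotProduct_sum, dotProduct_smul, smul_eq_mul]
      rw [hcol]
      exact abs_sum_mul_le hw (absSup_nonneg _ _) fun c =>
        hclass.abs_dotProduct_le_absSup (mlp_col_mem_layerClass hW0 t hWs c) ε
    have hexp : ∀ Z : Matrix (Fin N) (Fin h) ℝ, ∑ n, ε n * (Z *ᵥ w) n = ε ⬝ᵥ (Z *ᵥ w) :=
      fun _ => rfl
    rw [hexp, add_mulVec, add_mulVec, sum_mulVec, dotProduct_add, dotProduct_add, dotProduct_sum,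
      add_assoc]
    refine (abs_add_le _ _).trans (add_le_add hfirst ((abs_add_le _ _).trans (add_le_add ?_ ?_)))
    · refine (abs_sum_le_sum_abs _ _).trans (sum_le_sum fun k _ => ?_)
      rw [smul_mulVec, dotProduct_smul, smul_eq_mul, abs_mul, abs_of_nonneg (by positivity)]
      refine (mul_le_mul_of_nonneg_left (hprop k ε) (by positivity)).trans_eq ?_
      ring
    · rw [smul_mulVec, dotProduct_smul, smul_eq_mul, abs_mul, abs_of_nonneg (by positivity)]
      refine (mul_le_mul_of_nonneg_left (hprop L ε) (by positivity)).trans_eq ?_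
      ring
  · have hD := absSup_nonneg (layerClass σ X B T) ε
    have hS := fun k => spectralSum_nonneg hA k ε
    refine add_nonneg (by positivity) (add_nonneg (sum_nonneg fun k _ => ?_) ?_)
    · exact mul_nonneg (by positivity) (hS k)
    · exact mul_nonneg (by positivity) (hS L)
  · rw [tExp_add, tExp_add, tExp_sum]
    simp only [tExp_const_mul]
    have hmlp := tExp_absSup_layerClass_le (X := X) hp0 hp1 hσ hσ0 T hBl
    have hsum := sum_le_sum fun k (_ : k ∈ Finset.Icc 1 (L - 1)) =>
      mul_le_mul_of_nonneg_left (tExp_spectralSum_le hA hp0 hp1 k)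
        (show 0 ≤ (L : ℝ) * γ ^ k * ((B T) ^ k * B (T + 1)) * (Real.sqrt N * R) by positivity)
    have hlast := mul_le_mul_of_nonneg_left (tExp_spectralSum_le hA hp0 hp1 L)
      (show 0 ≤ γ ^ L * ((B T) ^ L * B (T + 1)) * (Real.sqrt N * R) by positivity)
    have hrw : ∑ k ∈ Finset.Icc 1 (L - 1), (L : ℝ) * γ ^ k * ((B T) ^ k * B (T + 1)) *
          (Real.sqrt N * R) * ∑ j, |hA.eigenvalues j| ^ k =
        B (T + 1) * (∑ k ∈ Finset.Icc 1 (L - 1),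
          (B T) ^ k * (L : ℝ) * γ ^ k * ∑ j, |hA.eigenvalues j| ^ k) * (Real.sqrt N * R) := by
      rw [mul_sum, sum_mul]
      exact sum_congr rfl fun k _ => by ring
    rw [hrw] at hsum
    have hS : 0 ≤ ∑ k ∈ Finset.Icc 1 (L - 1),
        (B T) ^ k * (L : ℝ) * γ ^ k * ∑ j, |hA.eigenvalues j| ^ k :=
      sum_nonneg fun k _ => by positivity
    have hSL : 0 ≤ γ ^ L * (B T) ^ L * ∑ j, |hA.eigenvalues j| ^ L := by positivity
    have hP : 0 ≤ (2 : ℝ) ^ T * (∏ l ∈ Finset.range T, B l) * Real.sqrt (2 * p) * frob X :=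
      mul_nonneg (mul_nonneg (mul_nonneg (by positivity)
        (prod_nonneg fun l hl => hBl l (mem_range.mp hl))) (Real.sqrt_nonneg _))
        (Real.sqrt_nonneg _)
    have hmlp' := mul_le_mul_of_nonneg_left hmlp hBout
    have hextra := mul_nonneg hBout (mul_nonneg hP (add_nonneg hS hSL))
    linarith
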